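/- arXiv:2503.09250 — 4 statements merged into one kernel-verified Lean document; each statement's English description precedes it below -/
import Mathlib

section
/- There exists a constant C > 0 depending only on N such that for all real numbers a and b one has |f(a+b) − f(a)| ≤ C( |a|^{4/(N−2)} |b| + |b|^{(N+2)/(N−2)} + |a|^{(6−N)/(N−2)} |b|² ). -/
theorem rpow_mul_self_sub_le {p x y : ℝ} (hp : 0 < p) (hx : 0 ≤ x) (hxy : x ≤ y) :
    y ^ p * y - x ^ p * x ≤ (p + 1) * y ^ p * (y - x) := by
  rcases (hx.trans hxy).eq_or_lt with rfl | hy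
  · obtain rfl := le_antisymm hxy hx
    simp
  have hs : -1 ≤ x / y - 1 := by linarith [div_nonneg hx hy.le]
  have h := one_add_mul_self_le_rpow_one_add hs (show 1 ≤ p + 1 by linarith)
  rw [add_sub_cancel, Real.div_rpow hx hy.le, Real.rpow_add_one' hx (by linarith),
    Real.rpow_add_one hy.ne', le_div_iff₀ (by positivity)] at h
  have e : (1 + (p + 1) * (x / y - 1)) * (y ^ p * y) =
      y ^ p * y - (p + 1) * y ^ p * (y - x) := by
    field_simp
    ring
  linarith

theorem abs_abs_rpow_mul_self_sub_le {p M x y : ℝ} (hp : 0 < p) (hx : |x| ≤ M) (hy : |y| ≤ M) :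
    |(|x| ^ p * x) - |y| ^ p * y| ≤ (p + 1) * M ^ p * |x - y| := by
  wlog hyx : y ≤ x generalizing x y
  · rw [abs_sub_comm, abs_sub_comm x]
    exact this hy hx (le_of_not_ge hyx)
  have key {u v : ℝ} (hu : 0 ≤ u) (huv : u ≤ v) (hv : v ≤ M) :
      |v ^ p * v - u ^ p * u| ≤ (p + 1) * M ^ p * (v - u) := by
    have hv0 := hu.trans huv
    have hmono : u ^ p * u ≤ v ^ p * v := by gcongr
    rw [abs_of_nonneg (sub_nonneg.2 hmono)]
    refine (rpow_mul_self_sub_le hp hu huv).trans ?_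
    have := sub_nonneg.2 huv
    gcongr
  rw [abs_of_nonneg (sub_nonneg.2 hyx)]
  rcases le_total 0 y with hy0 | hy0
  · have hx0 := hy0.trans hyx
    rw [abs_of_nonneg hx0] at hx ⊢
    rw [abs_of_nonneg hy0]
    exact key hy0 hyx hx
  rw [abs_of_nonpos hy0] at hy ⊢
  rcases le_total 0 x with hx0 | hx0
  · rw [abs_of_nonneg hx0] at hx ⊢
    have h₁ := key le_rfl hx0 hx
    have h₂ := key le_rfl (neg_nonneg.2 hy0) hy
    simp only [mul_zero, sub_zero] at h₁ h₂
    calc |x ^ p * x - (-y) ^ p * y| = |x ^ p * x + (-y) ^ p * -y| := by ring_nf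
      _ ≤ _ := (abs_add_le _ _).trans (by linarith)
  · rw [abs_of_nonpos hx0]
    convert key (neg_nonneg.2 hx0) (neg_le_neg hyx) hy using 2 <;> ring

theorem abs_abs_rpow_mul_self_add_sub_le {p : ℝ} (hp : 0 < p) (a b : ℝ) :
    |(|a + b| ^ p * (a + b)) - |a| ^ p * a| ≤
      (p + 1) * 2 ^ p * (|a| ^ p * |b| + |b| ^ (p + 1)) := by
  have h := abs_abs_rpow_mul_self_sub_le hp (abs_add_le a b)
    (le_add_of_nonneg_right (abs_nonneg b) : |a| ≤ |a| + |b|)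
  rw [add_sub_cancel_left] at h
  have hmax : (|a| + |b|) ^ p ≤ 2 ^ p * (|a| ^ p + |b| ^ p) := by
    calc (|a| + |b|) ^ p ≤ (2 * max |a| |b|) ^ p := by
          gcongr
          linarith [le_max_left |a| |b|, le_max_right |a| |b|]
      _ = 2 ^ p * max |a| |b| ^ p := Real.mul_rpow two_pos.le (by positivity)
      _ ≤ 2 ^ p * (|a| ^ p + |b| ^ p) := by
          gcongr
          rcases max_choice |a| |b| with h | h <;> rw [h]
          · exact le_add_of_nonneg_right (by positivity)
          · exact le_add_of_nonneg_left (by positivity)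
  calc _ ≤ (p + 1) * (|a| + |b|) ^ p * |b| := h
    _ ≤ (p + 1) * (2 ^ p * (|a| ^ p + |b| ^ p)) * |b| := by gcongr
    _ = _ := by
      rw [Real.rpow_add_one' (abs_nonneg b) (by linarith)]
      ring

/-- second inequality of Lemma 2.1:
For `3 ≤ N ≤ 6` and `f(s) = |s|^{4/(N-2)} s`, there is `C > 0` depending only on `N`
such that for all real `a, b`,
`|f(a+b) - f(a)| ≤ C (|a|^{4/(N-2)} |b| + |b|^{(N+2)/(N-2)} + |a|^{(6-N)/(N-2)} b²)`. -/
theorem stmt1 (N : ℕ) (hN1 : 3 ≤ N) (hN2 : N ≤ 6)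
    (f : ℝ → ℝ) (hf : ∀ s : ℝ, f s = |s| ^ ((4 : ℝ) / ((N : ℝ) - 2)) * s) :
    ∃ C : ℝ, 0 < C ∧ ∀ a b : ℝ,
      |f (a + b) - f a|
        ≤ C * (|a| ^ ((4 : ℝ) / ((N : ℝ) - 2)) * |b|
            + |b| ^ (((N : ℝ) + 2) / ((N : ℝ) - 2))
            + |a| ^ (((6 : ℝ) - (N : ℝ)) / ((N : ℝ) - 2)) * b ^ 2) := by
  have hN : (0 : ℝ) < (N : ℝ) - 2 := by
    have : (3 : ℝ) ≤ N := by exact_mod_cast hN1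
    linarith
  have hp : (0 : ℝ) < 4 / ((N : ℝ) - 2) := by positivity
  have hq : ((N : ℝ) + 2) / ((N : ℝ) - 2) = 4 / ((N : ℝ) - 2) + 1 := by
    field_simp
    ring
  refine ⟨(4 / ((N : ℝ) - 2) + 1) * 2 ^ (4 / ((N : ℝ) - 2)), by positivity, fun a b => ?_⟩
  rw [hf, hf, hq]
  refine (abs_abs_rpow_mul_self_add_sub_le hp a b).trans ?_
  exact mul_le_mul_of_nonneg_left (le_add_of_nonneg_right (by positivity)) (by positivity)
end

section
/- The supremum of H over the closed positive orthant {ν ∈ ℝ^k : ν_j ≥ 0 for all j} is attained; every maximizer s satisfies s_j > 0 for all j, and moreover every such maximizer satisfies the Euler–Lagrange system a_j² s_j − (Σ_{n=1}^k a_n s_n³) a_j s_j² = 0 for every j = 1, …, k. In particular the system 0 = a_j s_j − (Σ_{n=1}^k a_n s_n³) s_j² with s_j > 0 for all j = 1, …, k admits a solution s ∈ ℝ^k. -/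
/-- The functional `H(ν) = Σ_j a_j² ν_j²/2 − (1/6)(Σ_j a_j ν_j³)²` from Lemma 5.4. -/
noncomputable def Hfun (k : ℕ) (a : Fin k → ℝ) (ν : Fin k → ℝ) : ℝ :=
  (∑ j, (a j) ^ 2 * (ν j) ^ 2 / 2) - (1 / 6) * (∑ j, a j * (ν j) ^ 3) ^ 2

open Function in
theorem Hfun_update (k : ℕ) (a s : Fin k → ℝ) (j : Fin k) :
    ∃ B C : ℝ, (∑ n, a n * s n ^ 3 = B + a j * s j ^ 3) ∧
      ∀ t, Hfun k a (update s j t) = C + a j ^ 2 * t ^ 2 / 2 - 1 / 6 * (B + a j * t ^ 3) ^ 2 := by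
  refine ⟨∑ n ∈ Finset.univ.erase j, a n * s n ^ 3,
    ∑ n ∈ Finset.univ.erase j, a n ^ 2 * s n ^ 2 / 2, ?_, fun t => ?_⟩
  · exact (Finset.sum_erase_add _ _ (Finset.mem_univ j)).symm
  · have h₁ : ∀ n ∈ Finset.univ.erase j, update s j t n = s n := fun n hn =>
      update_of_ne (Finset.ne_of_mem_erase hn) _ _
    rw [Hfun, ← Finset.sum_erase_add _ _ (Finset.mem_univ j),
      ← Finset.sum_erase_add _ (fun n => a n * update s j t n ^ 3) (Finset.mem_univ j),
      Finset.sum_congr (g := fun n => a n ^ 2 * s n ^ 2 / 2) rfl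
        fun n hn => by rw [h₁ n hn],
      Finset.sum_congr (f := fun n => a n * update s j t n ^ 3) (g := fun n => a n * s n ^ 3) rfl
        fun n hn => by rw [h₁ n hn],
      update_self]

theorem Hfun_le_sum (k : ℕ) (a ν : Fin k → ℝ) (ha : ∀ j, 0 < a j) (hν : ∀ j, 0 ≤ ν j) :
    Hfun k a ν ≤ ∑ j, a j ^ 2 * (1 - ν j ^ 2 / 2) := by
  have h₁ : ∑ j, (a j * ν j ^ 3) ^ 2 ≤ (∑ j, a j * ν j ^ 3) ^ 2 :=
    Finset.sum_sq_le_sq_sum_of_nonneg fun j _ => mul_nonneg (ha j).le (pow_nonneg (hν j) 3)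
  have h₂ : ∑ j, a j ^ 2 * ν j ^ 2 / 2 - 1 / 6 * ∑ j, (a j * ν j ^ 3) ^ 2
      ≤ ∑ j, a j ^ 2 * (1 - ν j ^ 2 / 2) := by
    rw [Finset.mul_sum, ← Finset.sum_sub_distrib]
    refine Finset.sum_le_sum fun j _ => ?_
    have h₃ : ν j ^ 2 - (ν j ^ 2) ^ 3 / 6 ≤ 1 := by
      have := sq_nonneg (ν j)
      nlinarith [mul_nonneg this (sq_nonneg (ν j ^ 2 - 7 / 5)), sq_nonneg (ν j ^ 2 - 7 / 5)]
    nlinarith [mul_le_mul_of_nonneg_left h₃ (sq_nonneg (a j))]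
  unfold Hfun
  linarith

theorem exists_isMaxOn_Hfun (k : ℕ) (a : Fin k → ℝ) (ha : ∀ j, 0 < a j) :
    ∃ s : Fin k → ℝ, (∀ j, 0 ≤ s j) ∧
      ∀ ν : Fin k → ℝ, (∀ j, 0 ≤ ν j) → Hfun k a ν ≤ Hfun k a s := by
  set M : Fin k → ℝ := fun j => √(2 * ∑ n, a n ^ 2) / a j
  have hM : (0 : Fin k → ℝ) ≤ M := fun j => div_nonneg (Real.sqrt_nonneg _) (ha j).le
  have hcont : Continuous (Hfun k a) := by
    unfold Hfun
    fun_prop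
  obtain ⟨s, hs, hmax⟩ :=
    isCompact_Icc.exists_isMaxOn (Set.nonempty_Icc.2 hM) hcont.continuousOn
  refine ⟨s, hs.1, fun ν hν => ?_⟩
  by_cases hνM : ν ≤ M
  · exact hmax ⟨hν, hνM⟩
  have h₀ : Hfun k a 0 ≤ Hfun k a s := hmax ⟨le_rfl, hM⟩
  have h₀' : Hfun k a 0 = 0 := by simp [Hfun]
  refine le_trans ?_ (h₀'.symm.trans_le h₀)
  refine (Hfun_le_sum k a ν ha hν).trans ?_
  obtain ⟨j, hj⟩ : ∃ j, M j < ν j := by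
    simpa [Pi.le_def] using hνM
  have h₁ : √(2 * ∑ n, a n ^ 2) < ν j * a j := (div_lt_iff₀ (ha j)).1 hj
  have h₂ : 2 * ∑ n, a n ^ 2 < (ν j * a j) ^ 2 :=
    (Real.sqrt_lt' (mul_pos (hM j |>.trans_lt hj) (ha j))).1 h₁
  have h₃ : (ν j * a j) ^ 2 ≤ ∑ n, (ν n * a n) ^ 2 :=
    Finset.single_le_sum (f := fun n => (ν n * a n) ^ 2) (fun n _ => sq_nonneg _)
      (Finset.mem_univ j)
  have h₄ : ∑ n, a n ^ 2 * (1 - ν n ^ 2 / 2) = ∑ n, a n ^ 2 - 1 / 2 * ∑ n, (ν n * a n) ^ 2 := by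
    rw [Finset.mul_sum, ← Finset.sum_sub_distrib]
    exact Finset.sum_congr rfl fun n _ => by ring
  linarith

theorem exists_pos_lt_slice (b B : ℝ) (hb : 0 < b) (hB : 0 ≤ B) :
    ∃ t > 0, 1 / 6 * (B + b * t ^ 3) ^ 2 < b ^ 2 * t ^ 2 / 2 + 1 / 6 * B ^ 2 := by
  refine ⟨b / (b + B), by positivity, ?_⟩
  set t := b / (b + B) with ht
  have ht₀ : 0 < t := by positivity
  have ht₁ : t ≤ 1 := (div_le_one (by positivity)).2 (by linarith)
  have hBt : B * t ≤ b * (1 - t) := by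
    have : t * (b + B) = b := div_mul_cancel₀ _ (by positivity)
    linarith
  have h₁ : t ^ 4 ≤ 1 := pow_le_one₀ ht₀.le ht₁
  have h₂ : 0 < b * t ^ 2 := by positivity
  have h₃ : 2 * (B * t) + b * t ^ 4 < 3 * b := by
    nlinarith [mul_pos hb ht₀, mul_le_mul_of_nonneg_left h₁ hb.le]
  nlinarith [mul_lt_mul_of_pos_left h₃ h₂]

theorem pos_of_isMaxOn_Hfun (k : ℕ) (a s : Fin k → ℝ) (ha : ∀ j, 0 < a j) (hs : ∀ j, 0 ≤ s j)
    (hmax : ∀ ν : Fin k → ℝ, (∀ j, 0 ≤ ν j) → Hfun k a ν ≤ Hfun k a s) (j : Fin k) :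
    0 < s j := by
  refine (hs j).lt_of_ne fun h => ?_
  obtain ⟨B, C, hB, hH⟩ := Hfun_update k a s j
  have hB₀ : 0 ≤ B := by
    have : 0 ≤ ∑ n, a n * s n ^ 3 :=
      Finset.sum_nonneg fun n _ => mul_nonneg (ha n).le (pow_nonneg (hs n) 3)
    simpa [hB, ← h] using this
  obtain ⟨t, ht, hlt⟩ := exists_pos_lt_slice (a j) B (ha j) hB₀
  have h₁ := hmax (Function.update s j t) fun n => by
    rcases eq_or_ne n j with rfl | hn
    · simpa using ht.le
    · simpa [hn] using hs n
  have h₂ := hH (s j)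
  rw [Function.update_eq_self, ← h] at h₂
  rw [hH, h₂] at h₁
  norm_num at h₁
  linarith

theorem euler_lagrange_of_isMaxOn_Hfun (k : ℕ) (a s : Fin k → ℝ) (hs : ∀ j, 0 < s j)
    (hmax : ∀ ν : Fin k → ℝ, (∀ j, 0 ≤ ν j) → Hfun k a ν ≤ Hfun k a s) (j : Fin k) :
    a j ^ 2 * s j - (∑ n, a n * s n ^ 3) * (a j * s j ^ 2) = 0 := by
  obtain ⟨B, C, hB, hH⟩ := Hfun_update k a s j
  have hloc : IsLocalMax (fun t => Hfun k a (Function.update s j t)) (s j) := by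
    filter_upwards [lt_mem_nhds (hs j)] with t ht
    rw [Function.update_eq_self]
    refine hmax _ fun n => ?_
    rcases eq_or_ne n j with rfl | hn
    · simpa using ht.le
    · simpa [hn] using (hs n).le
  rw [funext hH] at hloc
  have hderiv := (((((hasDerivAt_id (s j)).pow 2).const_mul (a j ^ 2)).div_const 2).const_add
    C).sub (((((((hasDerivAt_id (s j)).pow 3).const_mul (a j)).const_add B).pow 2)).const_mul
      (1 / 6))
  have h₀ := hloc.hasDerivAt_eq_zero hderiv
  rw [hB]
  norm_num at h₀
  linear_combination h₀

/-- Lemma 5.4: the supremum of `H` over the closed positive orthant is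
attained; every maximizer has strictly positive coordinates and satisfies the
Euler–Lagrange system `a_j² s_j − (Σ_n a_n s_n³) a_j s_j² = 0`; in particular the system
`0 = a_j s_j − (Σ_n a_n s_n³) s_j²` with all `s_j > 0` has a solution. -/
theorem stmt2 (k : ℕ) (hk : 1 ≤ k) (a : Fin k → ℝ) (ha : ∀ j, 0 < a j) :
    (∃ s : Fin k → ℝ, (∀ j, 0 ≤ s j) ∧
        ∀ ν : Fin k → ℝ, (∀ j, 0 ≤ ν j) → Hfun k a ν ≤ Hfun k a s) ∧
    (∀ s : Fin k → ℝ,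
        ((∀ j, 0 ≤ s j) ∧ ∀ ν : Fin k → ℝ, (∀ j, 0 ≤ ν j) → Hfun k a ν ≤ Hfun k a s) →
      (∀ j, 0 < s j) ∧
        ∀ j, (a j) ^ 2 * s j - (∑ n, a n * (s n) ^ 3) * (a j * (s j) ^ 2) = 0) ∧
    (∃ s : Fin k → ℝ, (∀ j, 0 < s j) ∧
        ∀ j, 0 = a j * s j - (∑ n, a n * (s n) ^ 3) * (s j) ^ 2) := by
  have hmain : ∀ s : Fin k → ℝ,
      ((∀ j, 0 ≤ s j) ∧ ∀ ν : Fin k → ℝ, (∀ j, 0 ≤ ν j) → Hfun k a ν ≤ Hfun k a s) →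
      (∀ j, 0 < s j) ∧
        ∀ j, (a j) ^ 2 * s j - (∑ n, a n * (s n) ^ 3) * (a j * (s j) ^ 2) = 0 := by
    rintro s ⟨hs, hmax⟩
    have hpos := pos_of_isMaxOn_Hfun k a s ha hs hmax
    exact ⟨hpos, euler_lagrange_of_isMaxOn_Hfun k a s hpos hmax⟩
  obtain ⟨s, hs⟩ := exists_isMaxOn_Hfun k a ha
  obtain ⟨hpos, hEL⟩ := hmain s hs
  refine ⟨⟨s, hs⟩, hmain, s, hpos, fun j => ?_⟩
  refine mul_left_cancel₀ (ha j).ne' ?_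
  linear_combination -hEL j
end

section
/- Let U be a connected component of the open set {x ∈ Ω : G(x) ≠ 0}. Then there exists a point ξ ∈ U such that: G(ξ) ≠ 0; the gradient of G vanishes at ξ; ξ is a local extremum point of G (a local maximum if G > 0 on U and a local minimum if G < 0 on U); and the Hessian matrix of G at ξ is nonzero — indeed its trace equals ΔG(ξ) = −λ G(ξ) ≠ 0, so the orthogonal complement in ℝ^5 of the kernel of the Hessian of G at ξ is nontrivial. -/
/-- First partial derivative of `G` in the `i`-th coordinate direction. -/
noncomputable def pderiv5 (G : EuclideanSpace ℝ (Fin 5) → ℝ) (i : Fin 5)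
    (x : EuclideanSpace ℝ (Fin 5)) : ℝ :=
  fderiv ℝ G x (EuclideanSpace.single i 1)

/-- Second partial derivative `∂²G/∂x_i∂x_j`. -/
noncomputable def pderiv5' (G : EuclideanSpace ℝ (Fin 5) → ℝ) (i j : Fin 5)
    (x : EuclideanSpace ℝ (Fin 5)) : ℝ :=
  fderiv ℝ (pderiv5 G j) x (EuclideanSpace.single i 1)

/-- A closure point of a connected component of `S` that lies in `S`, with `S` open in a locally
connected space, belongs to that component. -/
theorem mem_connectedComponentIn_of_mem_closure {X : Type*} [TopologicalSpace X]
    [LocallyConnectedSpace X] {S : Set X} (hS : IsOpen S) {x y : X} (hyS : y ∈ S)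
    (hy : y ∈ closure (connectedComponentIn S x)) : y ∈ connectedComponentIn S x := by
  obtain ⟨z, hzy, hzx⟩ := mem_closure_iff.1 hy _ hS.connectedComponentIn
    (mem_connectedComponentIn hyS)
  rw [connectedComponentIn_eq hzx, ← connectedComponentIn_eq hzy]
  exact mem_connectedComponentIn hyS

/-- A continuous function on the closure of a bounded open set that vanishes on the boundary
attains the maximum of its absolute value over each nodal domain inside that domain. -/
theorem exists_isMaxOn_abs_nodal_domain {X : Type*} [PseudoMetricSpace X] [ProperSpace X]
    [LocallyConnectedSpace X] {Ω : Set X} (hΩo : IsOpen Ω) (hΩb : Bornology.IsBounded Ω)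
    {G : X → ℝ} (hGc : ContinuousOn G (closure Ω)) (hGbd : ∀ x ∈ frontier Ω, G x = 0)
    {x₀ : X} (hx₀ : x₀ ∈ {x ∈ Ω | G x ≠ 0}) :
    ∃ ξ ∈ connectedComponentIn {x ∈ Ω | G x ≠ 0} x₀,
      IsMaxOn (fun x => |G x|) (connectedComponentIn {x ∈ Ω | G x ≠ 0} x₀) ξ := by
  have hS : IsOpen {x ∈ Ω | G x ≠ 0} :=
    (hGc.mono subset_closure).isOpen_inter_preimage hΩo isOpen_compl_singleton
  set U := connectedComponentIn {x ∈ Ω | G x ≠ 0} x₀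
  have hUΩ : U ⊆ Ω := fun x hx => (connectedComponentIn_subset _ _ hx).1
  have hx₀U : x₀ ∈ U := mem_connectedComponentIn hx₀
  obtain ⟨ξ, hξ, hmax⟩ := (hΩb.subset hUΩ).isCompact_closure.exists_isMaxOn
    ⟨x₀, subset_closure hx₀U⟩ (hGc.mono (closure_mono hUΩ)).abs
  have hGξ : G ξ ≠ 0 :=
    abs_pos.1 ((abs_pos.2 hx₀.2).trans_le (hmax (subset_closure hx₀U)))
  have hξΩ : ξ ∈ Ω := by
    by_contra h
    refine hGξ (hGbd ξ ?_)
    rw [hΩo.frontier_eq]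
    exact ⟨closure_mono hUΩ hξ, h⟩
  exact ⟨ξ, mem_connectedComponentIn_of_mem_closure hS ⟨hξΩ, hGξ⟩ hξ,
    hmax.on_subset subset_closure⟩

/-- Lemma 5.3: let `G` be continuous on `Ω̄`, `C²` on `Ω`, vanishing on
`∂Ω`, not identically zero, and satisfying `−ΔG = λ G` on `Ω` with `λ ≠ 0`.  In every
connected component `U` of `{x ∈ Ω : G x ≠ 0}` there is a point `ξ` with `G ξ ≠ 0`,
vanishing gradient, which is a local maximum if `G > 0` on `U` and a local minimum if
`G < 0` on `U`, and at which the Hessian is nonzero: its trace equals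
`ΔG(ξ) = −λ G(ξ) ≠ 0`, so the orthogonal complement of the kernel of the Hessian is
nontrivial. -/
theorem stmt11 (Ω : Set (EuclideanSpace ℝ (Fin 5))) (hΩo : IsOpen Ω)
    (hΩb : Bornology.IsBounded Ω)
    (G : EuclideanSpace ℝ (Fin 5) → ℝ) (lam : ℝ) (hlam : lam ≠ 0)
    (hGc : ContinuousOn G (closure Ω)) (hG2 : ContDiffOn ℝ 2 G Ω)
    (hGbd : ∀ x ∈ frontier Ω, G x = 0)
    (hEig : ∀ x ∈ Ω, -(∑ i, pderiv5' G i i x) = lam * G x)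
    (hG0 : ∃ x ∈ Ω, G x ≠ 0)
    (U : Set (EuclideanSpace ℝ (Fin 5)))
    (hU : ∃ x₀ ∈ {x ∈ Ω | G x ≠ 0}, U = connectedComponentIn {x ∈ Ω | G x ≠ 0} x₀) :
    ∃ ξ ∈ U, G ξ ≠ 0 ∧
      (∀ i, pderiv5 G i ξ = 0) ∧
      ((∀ x ∈ U, 0 < G x) → IsLocalMax G ξ) ∧
      ((∀ x ∈ U, G x < 0) → IsLocalMin G ξ) ∧
      (∑ i, pderiv5' G i i ξ) = -(lam * G ξ) ∧
      lam * G ξ ≠ 0 ∧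
      (fun i j => pderiv5' G i j ξ : Matrix (Fin 5) (Fin 5) ℝ) ≠ 0 := by
  obtain ⟨x₀, hx₀, rfl⟩ := hU
  obtain ⟨ξ, hξ, hmax⟩ := exists_isMaxOn_abs_nodal_domain hΩo hΩb hGc hGbd hx₀
  obtain ⟨hξΩ, hGξ⟩ := connectedComponentIn_subset _ _ hξ
  have hS : IsOpen {x ∈ Ω | G x ≠ 0} :=
    hG2.continuousOn.isOpen_inter_preimage hΩo isOpen_compl_singleton
  have hloc : ∀ᶠ x in nhds ξ, |G x| ≤ |G ξ| :=
    Filter.mem_of_superset (hS.connectedComponentIn.mem_nhds hξ) fun x hx => hmax hx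
  have hlocMax (h : 0 < G ξ) : IsLocalMax G ξ :=
    hloc.mono fun x hx => (le_abs_self _).trans (hx.trans_eq (abs_of_pos h))
  have hlocMin (h : G ξ < 0) : IsLocalMin G ξ := hloc.mono fun x hx => by
    rw [abs_of_neg h] at hx
    exact neg_le_neg_iff.1 ((neg_le_abs _).trans hx)
  have hgrad : fderiv ℝ G ξ = 0 :=
    hGξ.lt_or_gt.elim (fun h => (hlocMin h).fderiv_eq_zero) fun h => (hlocMax h).fderiv_eq_zero
  have htrace : ∑ i, pderiv5' G i i ξ = -(lam * G ξ) := neg_eq_iff_eq_neg.1 (hEig ξ hξΩ)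
  have hlamG : lam * G ξ ≠ 0 := mul_ne_zero hlam hGξ
  refine ⟨ξ, hξ, hGξ, fun i => by simp [pderiv5, hgrad], fun h => hlocMax (h ξ hξ),
    fun h => hlocMin (h ξ hξ), htrace, hlamG, fun h => hlamG ?_⟩
  have hdiag (i : Fin 5) : pderiv5' G i i ξ = 0 := congrFun (congrFun h i) i
  simpa [hdiag] using htrace
end

section
/- The supremum of H* over S^{m−1} × Ω̄^k is attained at some point (t₀, ξ₀) with t₀ ∈ S^{m−1} and ξ₀ = (ξ_{1,0}, …, ξ_{k,0}) ∈ Ω̄^k. Moreover, every maximizer (t₀, ξ₀) satisfies ξ_{j,0} ∈ Ω (i.e., each ξ_{j,0} is an interior point) for all j = 1, …, k, and solves the Euler–Lagrange system: (i) Σ_{l=1}^m t_{l,0} ∂e_l/∂x_i (ξ_{j,0}) = 0 for all 1 ≤ j ≤ k and 1 ≤ i ≤ 4; and (ii) ‖Σ_{n=1}^m t_{n,0} e_n‖₂² · Σ_{j=1}^k (Σ_{n=1}^m t_{n,0} e_n(ξ_{j,0})) e_l(ξ_{j,0}) − ( Σ_{j=1}^k (Σ_{n=1}^m t_{n,0}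 e_n(ξ_{j,0}))² ) ‖e_l‖₂² t_{l,0} = 0 for all 1 ≤ l ≤ m. -/
open MeasureTheory

/-- The functional `H*(ν, η) = (Σ_j (Σ_l ν_l e_l(η_j))²) / ‖Σ_l ν_l e_l‖₂²` from
Lemma 5.1 (N = 4). -/
noncomputable def Hstar {m k : ℕ} (Ω : Set (EuclideanSpace ℝ (Fin 4)))
    (e : Fin m → EuclideanSpace ℝ (Fin 4) → ℝ)
    (ν : Fin m → ℝ) (η : Fin k → EuclideanSpace ℝ (Fin 4)) : ℝ :=
  (∑ j, (∑ l, ν l * e l (η j)) ^ 2) / (∫ x in Ω, (∑ l, ν l * e l x) ^ 2)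

/-- Continuous functions on the closure of a bounded set have an integrable product there. -/
theorem integrableOn_mul_of_continuousOn_closure {E : Type*} [PseudoMetricSpace E] [ProperSpace E]
    [MeasurableSpace E] [OpensMeasurableSpace E] {μ : Measure E} [IsFiniteMeasureOnCompacts μ]
    {Ω : Set E} (hΩ : Bornology.IsBounded Ω) {f g : E → ℝ}
    (hf : ContinuousOn f (closure Ω)) (hg : ContinuousOn g (closure Ω)) :
    IntegrableOn (fun x => f x * g x) Ω μ :=
  ((hf.mul hg).integrableOn_compact' hΩ.isCompact_closure
    isClosed_closure.measurableSet).mono_set subset_closure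

/-- Pythagoras: the squared `L²` norm of a combination of pairwise orthogonal functions. -/
theorem integral_sum_mul_sq_of_orthogonal {ι X : Type*} [Fintype ι] [MeasurableSpace X]
    {μ : Measure X} {e : ι → X → ℝ}
    (hint : ∀ l n, Integrable (fun x => e l x * e n x) μ)
    (horth : ∀ l n, l ≠ n → (∫ x, e l x * e n x ∂μ) = 0) (ν : ι → ℝ) :
    (∫ x, (∑ l, ν l * e l x) ^ 2 ∂μ) = ∑ l, ν l ^ 2 * ∫ x, e l x ^ 2 ∂μ := by
  have hexp : ∀ x, (∑ l, ν l * e l x) ^ 2 = ∑ l, ∑ n, ν l * ν n * (e l x * e n x) := by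
    intro x
    rw [sq, Finset.sum_mul_sum]
    exact Finset.sum_congr rfl fun l _ => Finset.sum_congr rfl fun n _ => by ring
  simp_rw [hexp]
  rw [integral_finsetSum _ fun l _ => integrable_finsetSum _ fun n _ => (hint l n).const_mul _]
  refine Finset.sum_congr rfl fun l _ => ?_
  rw [integral_finsetSum _ fun n _ => (hint l n).const_mul _, Finset.sum_eq_single l]
  · rw [integral_const_mul, sq]
    simp_rw [sq]
  · intro n _ hn
    rw [integral_const_mul, horth l n hn.symm, mul_zero]
  · simp

theorem sum_sq_mul_pos_of_sum_sq_pos {ι : Type*} [Fintype ι] {w ν : ι → ℝ} (hw : ∀ l, 0 < w l)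
    (hν : 0 < ∑ l, ν l ^ 2) : 0 < ∑ l, ν l ^ 2 * w l := by
  obtain ⟨l, hl, hl0⟩ := Finset.exists_ne_zero_of_sum_ne_zero hν.ne'
  exact Finset.sum_pos' (fun i _ => mul_nonneg (sq_nonneg _) (hw i).le)
    ⟨l, hl, mul_pos ((sq_nonneg _).lt_of_ne' hl0) (hw l)⟩

theorem isCompact_setOf_sum_sq_eq_one (ι : Type*) [Fintype ι] :
    IsCompact {t : ι → ℝ | ∑ l, t l ^ 2 = 1} := by
  refine Metric.isCompact_of_isClosed_isBounded
    (isClosed_eq (by fun_prop) continuous_const) ?_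
  refine (Metric.isBounded_closedBall (x := (0 : ι → ℝ)) (r := 1)).subset fun t ht => ?_
  rw [mem_closedBall_zero_iff, pi_norm_le_iff_of_nonneg zero_le_one]
  intro l
  rw [Real.norm_eq_abs, ← sq_le_one_iff_abs_le_one, ← show ∑ l, t l ^ 2 = 1 from ht]
  exact Finset.single_le_sum (f := fun l => t l ^ 2) (fun i _ => sq_nonneg _) (Finset.mem_univ l)

/-- If a sum of values of `g` cannot be increased by moving one point inside `s`, then each point
maximizes `g` on `s`. -/
theorem le_of_forall_sum_comp_le {ι X : Type*} [Fintype ι] [DecidableEq ι] {s : Set X} {g : X → ℝ}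
    {ξ : ι → X} (hξ : ∀ j, ξ j ∈ s)
    (hmax : ∀ η : ι → X, (∀ j, η j ∈ s) → ∑ j, g (η j) ≤ ∑ j, g (ξ j))
    (j : ι) {x : X} (hx : x ∈ s) : g x ≤ g (ξ j) := by
  have h := hmax (Function.update ξ j x) fun i => by
    rcases eq_or_ne i j with rfl | hij
    · simpa using hx
    · simpa [hij] using hξ i
  rw [← Finset.add_sum_erase _ _ (Finset.mem_univ j),
    ← Finset.add_sum_erase _ (fun i => g (ξ i)) (Finset.mem_univ j), Function.update_self,
    Finset.sum_congr rfl fun i hi => by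
      rw [Function.update_of_ne (Finset.ne_of_mem_erase hi)]] at h
  exact le_of_add_le_add_right h

/-- A function is critical at a point where its square has a nonzero local maximum. -/
theorem fderiv_eq_zero_of_isLocalMax_sq {E : Type*} [NormedAddCommGroup E] [NormedSpace ℝ E]
    {f : E → ℝ} {a : E} (hf : DifferentiableAt ℝ f a) (ha : f a ≠ 0)
    (hmax : IsLocalMax (fun x => f x ^ 2) a) : fderiv ℝ f a = 0 := by
  have h := hmax.fderiv_eq_zero
  rw [(hf.hasFDerivAt.pow 2).fderiv] at h
  simpa [ha] using h

theorem eq_zero_of_forall_quadratic_nonneg {a b : ℝ} (h : ∀ s : ℝ, 0 ≤ a * s ^ 2 + b * s) :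
    b = 0 := by
  have hd := discrim_le_zero (a := a) (b := b) (c := 0) fun s => by linarith [h s, sq s]
  rw [discrim] at hd
  nlinarith [sq_nonneg b]

/-- Euler–Lagrange equation for maximizing the quotient of the quadratic forms
`∑ j, (∑ l, ν l * A l j) ^ 2` and `∑ l, ν l ^ 2 * w l`. -/
theorem eulerLagrange_of_quadratic_quotient_le {ι κ : Type*} [Fintype ι] [DecidableEq ι]
    [Fintype κ] {A : ι → κ → ℝ} {w t : ι → ℝ}
    (h : ∀ ν : ι → ℝ, (∑ j, (∑ n, ν n * A n j) ^ 2) * (∑ n, t n ^ 2 * w n) ≤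
      (∑ j, (∑ n, t n * A n j) ^ 2) * ∑ n, ν n ^ 2 * w n) (l : ι) :
    (∑ n, t n ^ 2 * w n) * (∑ j, (∑ n, t n * A n j) * A l j) -
      (∑ j, (∑ n, t n * A n j) ^ 2) * w l * t l = 0 := by
  set N := ∑ j, (∑ n, t n * A n j) ^ 2 with hN
  set D := ∑ n, t n ^ 2 * w n with hD
  have hlin : ∀ (s : ℝ) (j : κ), ∑ n, (t + Pi.single l s : ι → ℝ) n * A n j =
      ∑ n, t n * A n j + s * A l j := by
    intro s j
    simp [add_mul, Finset.sum_add_distrib, Pi.single_apply]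
  have hnum : ∀ s : ℝ, ∑ j, (∑ n, (t + Pi.single l s : ι → ℝ) n * A n j) ^ 2 =
      N + 2 * s * (∑ j, (∑ n, t n * A n j) * A l j) + s ^ 2 * ∑ j, A l j ^ 2 := by
    intro s
    simp_rw [hlin, hN, Finset.mul_sum, ← Finset.sum_add_distrib]
    exact Finset.sum_congr rfl fun j _ => by ring
  have hden : ∀ s : ℝ, ∑ n, (t + Pi.single l s : ι → ℝ) n ^ 2 * w n =
      D + 2 * s * (t l * w l) + s ^ 2 * w l := by
    intro s
    have hterm : ∀ n, (t + Pi.single l s : ι → ℝ) n ^ 2 * w n =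
        t n ^ 2 * w n + if n = l then 2 * s * (t l * w l) + s ^ 2 * w l else 0 := by
      intro n
      rcases eq_or_ne n l with rfl | hn
      · simp; ring
      · simp [hn]
    simp_rw [hterm, Finset.sum_add_distrib, hD]
    simp [add_assoc]
  have hq := eq_zero_of_forall_quadratic_nonneg
    (a := N * w l - D * ∑ j, A l j ^ 2)
    (b := 2 * (N * w l * t l - D * ∑ j, (∑ n, t n * A n j) * A l j)) fun s => by
      have := h (t + Pi.single l s)
      rw [hnum, hden] at this
      linarith
  linarith

/-- An inequality between quadratic forms on the unit sphere extends to the whole space. -/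
theorem quadratic_le_of_le_on_sphere {ι : Type*} [Fintype ι] {P Q : (ι → ℝ) → ℝ}
    (hP : ∀ (c : ℝ) ν, P (c • ν) = c ^ 2 * P ν) (hQ : ∀ (c : ℝ) ν, Q (c • ν) = c ^ 2 * Q ν)
    (h : ∀ ν : ι → ℝ, ∑ l, ν l ^ 2 = 1 → P ν ≤ Q ν) (ν : ι → ℝ) : P ν ≤ Q ν := by
  have hr : 0 ≤ ∑ l, ν l ^ 2 := Finset.sum_nonneg fun l _ => sq_nonneg _
  rcases hr.eq_or_lt with h0 | hpos
  · have hν : ν = 0 • ν := by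
      ext l
      simpa using (Finset.sum_eq_zero_iff_of_nonneg fun i _ => sq_nonneg (ν i)).1 h0.symm l
        (Finset.mem_univ l)
    have h1 := hP 0 ν
    have h2 := hQ 0 ν
    simp only [zero_smul] at hν h1 h2
    rw [hν, h1, h2]
    simp
  · set r := ∑ l, ν l ^ 2 with hrdef
    have hc : (Real.sqrt r)⁻¹ ^ 2 = r⁻¹ := by rw [inv_pow, Real.sq_sqrt hr]
    have key := h ((Real.sqrt r)⁻¹ • ν) (by
      simp only [Pi.smul_apply, smul_eq_mul, mul_pow, hc, ← Finset.mul_sum]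
      exact inv_mul_cancel₀ hpos.ne')
    rw [hP, hQ, hc] at key
    exact le_of_mul_le_mul_left key (inv_pos.2 hpos)

/-- Lemma 5.1: the supremum of `H*` over `S^{m−1} × Ω̄^k` is attained;
every maximizer `(t₀, ξ₀)` has all concentration points in the interior of `Ω` and solves
the Euler–Lagrange system (i) `Σ_l t_{l,0} ∂e_l/∂x_i(ξ_{j,0}) = 0` and (ii)
`‖Σ t₀ e‖₂² Σ_j (Σ t₀ e(ξ_{j,0})) e_l(ξ_{j,0}) − (Σ_j (Σ t₀ e(ξ_{j,0}))²) ‖e_l‖₂² t_{l,0} = 0`. -/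
theorem stmt12 (m k : ℕ) (hm : 1 ≤ m) (hk : 1 ≤ k)
    (Ω : Set (EuclideanSpace ℝ (Fin 4))) (hΩo : IsOpen Ω)
    (hΩb : Bornology.IsBounded Ω)
    (e : Fin m → EuclideanSpace ℝ (Fin 4) → ℝ)
    (hec : ∀ l, ContinuousOn (e l) (closure Ω))
    (he1 : ∀ l, ContDiffOn ℝ 1 (e l) Ω)
    (hebd : ∀ l, ∀ x ∈ frontier Ω, e l x = 0)
    (horth : ∀ l n, l ≠ n → (∫ x in Ω, e l x * e n x) = 0)
    (hne : ∀ l, 0 < ∫ x in Ω, (e l x) ^ 2) :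
    (∃ (t₀ : Fin m → ℝ) (ξ₀ : Fin k → EuclideanSpace ℝ (Fin 4)),
      (∑ l, (t₀ l) ^ 2) = 1 ∧ (∀ j, ξ₀ j ∈ closure Ω) ∧
        ∀ (ν : Fin m → ℝ) (η : Fin k → EuclideanSpace ℝ (Fin 4)),
          (∑ l, (ν l) ^ 2) = 1 → (∀ j, η j ∈ closure Ω) →
            Hstar Ω e ν η ≤ Hstar Ω e t₀ ξ₀) ∧
    (∀ (t₀ : Fin m → ℝ) (ξ₀ : Fin k → EuclideanSpace ℝ (Fin 4)),
      ((∑ l, (t₀ l) ^ 2) = 1 ∧ (∀ j, ξ₀ j ∈ closure Ω) ∧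
        ∀ (ν : Fin m → ℝ) (η : Fin k → EuclideanSpace ℝ (Fin 4)),
          (∑ l, (ν l) ^ 2) = 1 → (∀ j, η j ∈ closure Ω) →
            Hstar Ω e ν η ≤ Hstar Ω e t₀ ξ₀) →
      (∀ j, ξ₀ j ∈ Ω) ∧
      (∀ (j : Fin k) (i : Fin 4),
        (∑ l, t₀ l * fderiv ℝ (e l) (ξ₀ j) (EuclideanSpace.single i 1)) = 0) ∧
      (∀ l, (∫ x in Ω, (∑ n, t₀ n * e n x) ^ 2) *
            (∑ j, (∑ n, t₀ n * e n (ξ₀ j)) * e l (ξ₀ j)) -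
          (∑ j, (∑ n, t₀ n * e n (ξ₀ j)) ^ 2) * (∫ x in Ω, (e l x) ^ 2) * t₀ l = 0)) := by
  classical
  have hden : ∀ ν : Fin m → ℝ, (∫ x in Ω, (∑ l, ν l * e l x) ^ 2) =
      ∑ l, ν l ^ 2 * ∫ x in Ω, e l x ^ 2 :=
    integral_sum_mul_sq_of_orthogonal
      (fun l n => integrableOn_mul_of_continuousOn_closure hΩb (hec l) (hec n)) horth
  have hpos : ∀ ν : Fin m → ℝ, ∑ l, ν l ^ 2 = 1 → 0 < ∑ l, ν l ^ 2 * ∫ x in Ω, e l x ^ 2 :=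
    fun ν hν => sum_sq_mul_pos_of_sum_sq_pos hne (hν ▸ one_pos)
  have hexists : ∀ ν : Fin m → ℝ, ∑ l, ν l ^ 2 = 1 → ∃ x ∈ Ω, ∑ l, ν l * e l x ≠ 0 := by
    intro ν hν
    by_contra! hzero
    have hint := hden ν
    rw [setIntegral_congr_fun (g := fun _ => (0 : ℝ)) hΩo.measurableSet fun x hx => by
      simp [hzero x hx], integral_zero] at hint
    exact (hpos ν hν).ne hint
  constructor
  · have hsphere : ∑ l, (Pi.single ⟨0, hm⟩ 1 : Fin m → ℝ) l ^ 2 = 1 := by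
      simp [Pi.single_apply]
    obtain ⟨x₀, hx₀, -⟩ := hexists _ hsphere
    have hcont : ContinuousOn
        (fun p : (Fin m → ℝ) × (Fin k → EuclideanSpace ℝ (Fin 4)) => Hstar Ω e p.1 p.2)
        ({t | ∑ l, t l ^ 2 = 1} ×ˢ Set.univ.pi fun _ => closure Ω) := by
      simp only [Hstar, hden]
      refine ContinuousOn.div ?_ (by fun_prop) fun p hp => (hpos _ hp.1).ne'
      refine continuousOn_finsetSum _ fun j _ => (continuousOn_finsetSum _ fun l _ => ?_).pow 2
      exact ContinuousOn.mul (by fun_prop)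
        ((hec l).comp (by fun_prop) fun p hp => hp.2 j (Set.mem_univ j))
    obtain ⟨⟨t₀, ξ₀⟩, ⟨ht₀, hξ₀⟩, hmax⟩ :=
      ((isCompact_setOf_sum_sq_eq_one (Fin m)).prod
        (isCompact_univ_pi fun _ => hΩb.isCompact_closure)).exists_isMaxOn
        ⟨(Pi.single ⟨0, hm⟩ 1, fun _ => x₀), hsphere, fun _ _ => subset_closure hx₀⟩ hcont
    exact ⟨t₀, ξ₀, ht₀, fun j => hξ₀ j (Set.mem_univ j), fun ν η hν hη =>
      hmax (a := (ν, η)) ⟨hν, fun j _ => hη j⟩⟩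
  · rintro t₀ ξ₀ ⟨ht₀, hξ₀, hmax⟩
    have hpoint : ∀ j, ∀ x ∈ closure Ω,
        (∑ l, t₀ l * e l x) ^ 2 ≤ (∑ l, t₀ l * e l (ξ₀ j)) ^ 2 := by
      intro j x hx
      refine le_of_forall_sum_comp_le (g := fun x => (∑ l, t₀ l * e l x) ^ 2) hξ₀
        (fun η hη => ?_) j hx
      have h := hmax t₀ η ht₀ hη
      rw [Hstar, Hstar, hden] at h
      exact (div_le_div_iff_of_pos_right (hpos t₀ ht₀)).1 h
    have hval : ∀ j, ∑ l, t₀ l * e l (ξ₀ j) ≠ 0 := by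
      intro j hj
      obtain ⟨x, hx, hx0⟩ := hexists t₀ ht₀
      have h := hpoint j x (subset_closure hx)
      rw [hj] at h
      exact (pow_pos (abs_pos.2 hx0) 2).not_ge (by simpa using h)
    have hmem : ∀ j, ξ₀ j ∈ Ω := by
      intro j
      by_contra hj
      refine hval j (Finset.sum_eq_zero fun l _ => ?_)
      rw [hebd l _ (hΩo.frontier_eq ▸ ⟨hξ₀ j, hj⟩), mul_zero]
    refine ⟨hmem, fun j i => ?_, fun l => ?_⟩
    · have hnhds := hΩo.mem_nhds (hmem j)
      have hdiff : ∀ l, DifferentiableAt ℝ (e l) (ξ₀ j) := fun l =>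
        ((he1 l).differentiableOn one_ne_zero).differentiableAt hnhds
      have hcrit := fderiv_eq_zero_of_isLocalMax_sq
        (f := fun x => ∑ l, t₀ l * e l x) (by fun_prop) (hval j)
        (Filter.mem_of_superset hnhds fun x hx => hpoint j x (subset_closure hx))
      rw [fderiv_fun_sum fun l _ => (hdiff l).const_mul _] at hcrit
      have happ := congrArg (fun L => L (EuclideanSpace.single i 1)) hcrit
      simpa [fderiv_const_mul, hdiff] using happ
    · rw [hden]
      refine eulerLagrange_of_quadratic_quotient_le (A := fun n j => e n (ξ₀ j)) ?_ l
      refine quadratic_le_of_le_on_sphere (fun c ν => ?_) (fun c ν => ?_) fun ν hν => ?_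
      · simp only [Pi.smul_apply, smul_eq_mul, mul_assoc, ← Finset.mul_sum, mul_pow]
      · simp only [Pi.smul_apply, smul_eq_mul, mul_assoc, ← Finset.mul_sum, mul_pow]
        ring
      · have h := hmax ν ξ₀ hν hξ₀
        rw [Hstar, Hstar, hden, hden] at h
        exact (div_le_div_iff₀ (hpos ν hν) (hpos t₀ ht₀)).1 h
end
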